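/- Let X be a paracompact Hausdorff space and n < ω. Then X has covering dimension dim(X) ≤ n if and only if for every Hausdorff topological space Y and every finite aspherical sequence φ_0, …, φ_n : X ⇝ Y of lower locally constant set-valued mappings, the mapping φ_n has a continuous selection. -/

import Mathlib

/-- `EmbedIn k S B` means `S ↪_k B`: every continuous map from the unit `k`-sphere of
`ℝ^{k+1}` into `S` extends to a continuous map from the closed unit `(k+1)`-ball into `B`. -/
def EmbedIn {Y : Type*} [TopologicalSpace Y] (k : ℕ) (S B : Set Y) : Prop :=
  ∀ f : (Metric.sphere (0 : EuclideanSpace ℝ (Fin (k + 1))) 1) → Y,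
    Continuous f → Set.range f ⊆ S →
      ∃ g : (Metric.closedBall (0 : EuclideanSpace ℝ (Fin (k + 1))) 1) → Y,
        Continuous g ∧ Set.range g ⊆ B ∧
          ∀ z, g (Set.inclusion Metric.sphere_subset_closedBall z) = f z

/-- A set-valued mapping `Φ : X ⇝ Y` is lower locally constant if
`{x | K ⊆ Φ x}` is open for every compact `K ⊆ Y`. -/
def LowerLocallyConstant {X Y : Type*} [TopologicalSpace X] [TopologicalSpace Y]
    (Φ : X → Set Y) : Prop :=
  ∀ K : Set Y, IsCompact K → IsOpen {x | K ⊆ Φ x}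

/-- `X` has covering dimension at most `n`: every open cover of `X` admits an open
refinement covering `X` in which every point belongs to at most `n + 1` members. -/
def CovDimLE (X : Type*) [TopologicalSpace X] (n : ℕ) : Prop :=
  ∀ U : Set (Set X), (∀ u ∈ U, IsOpen u) → ⋃₀ U = Set.univ →
    ∃ V : Set (Set X),
      (∀ v ∈ V, IsOpen v) ∧
      (∀ v ∈ V, ∃ u ∈ U, v ⊆ u) ∧
      ⋃₀ V = Set.univ ∧
      ∀ x : X, {v ∈ V | x ∈ v}.Finite ∧ {v ∈ V | x ∈ v}.ncard ≤ n + 1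

open Set Topology

/-- Every open cover of a paracompact Hausdorff space has a `σ`-disjoint open refinement, indexed
by finite sets so that members with indices of equal cardinality are disjoint. -/
theorem exists_disjoint_of_card_eq_refinement {X ι : Type*} [TopologicalSpace X] [T2Space X]
    [ParacompactSpace X] (U : ι → Set X) (hU : ∀ i, IsOpen (U i)) (hcov : ⋃ i, U i = univ) :
    ∃ W : Finset ι → Set X, (∀ F, IsOpen (W F)) ∧ (∀ F, (W F).Nonempty → ∃ i, W F ⊆ U i) ∧
      (∀ x, ∃ F, x ∈ W F) ∧
      ∀ F F' x, F.card = F'.card → x ∈ W F → x ∈ W F' → F = F' := by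
  classical
  obtain ⟨f, hf⟩ := PartitionOfUnity.exists_isSubordinate isClosed_univ U hU hcov.ge
  refine ⟨fun F => {x | F.Nonempty ∧ ∀ a ∈ F, 0 < f a x ∧ ∀ b ∉ F, f b x < f a x},
    fun F => ?_, ?_, fun x => ?_, ?_⟩
  · rcases F.eq_empty_or_nonempty with rfl | hF
    · simp
    · beta_reduce
      have key : {x | F.Nonempty ∧ ∀ a ∈ F, 0 < f a x ∧ ∀ b ∉ F, f b x < f a x} =
          ⋂ a ∈ F, ({x | 0 < f a x} ∩
            (⋃ b : {b // b ∉ F}, tsupport (f b) ∩ {x | f a x ≤ f b x})ᶜ) := by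
        ext x
        simp only [mem_ofPred_eq, hF, true_and, mem_iInter, mem_inter_iff, mem_compl_iff,
          mem_iUnion, not_exists, not_and, not_le, Subtype.forall]
        refine forall₂_congr fun a _ => and_congr_right fun ha => forall₂_congr fun b _ =>
          ⟨fun h _ => h, fun h => ?_⟩
        by_cases hb : x ∈ tsupport (f b)
        · exact h hb
        · rwa [image_eq_zero_of_notMem_tsupport hb]
      rw [key]
      refine isOpen_biInter_finset fun a _ =>
        (isOpen_lt continuous_const (f a).continuous).inter (isOpen_compl_iff.2 ?_)
      refine LocallyFinite.isClosed_iUnion ?_ fun b =>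
        (isClosed_tsupport _).inter (isClosed_le (f a).continuous (f b).continuous)
      exact (f.locallyFinite_tsupport.comp_injective Subtype.val_injective).subset
        fun b => inter_subset_left
  · rintro F ⟨x, hF, -⟩
    obtain ⟨a, ha⟩ := hF
    exact ⟨a, fun y hy => hf a (subset_tsupport _ (hy.2 a ha).1.ne')⟩
  · refine ⟨f.finsupport x, ?_, fun a ha => ?_⟩
    · obtain ⟨a, ha⟩ := f.exists_pos (mem_univ x)
      exact ⟨a, (f.mem_finsupport x).2 ha.ne'⟩
    · have hpos : 0 < f a x := lt_of_le_of_ne (f.nonneg a x) (Ne.symm ((f.mem_finsupport x).1 ha))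
      refine ⟨hpos, fun b hb => ?_⟩
      have : f b x = 0 := by
        by_contra h
        exact hb ((f.mem_finsupport x).2 h)
      rwa [this]
  · rintro F F' x hcard ⟨-, h⟩ ⟨-, h'⟩
    by_contra hne
    have h1 : ¬ F ⊆ F' := fun hs => hne (Finset.eq_of_subset_of_card_le hs hcard.ge)
    have h2 : ¬ F' ⊆ F := fun hs => hne (Finset.eq_of_subset_of_card_le hs hcard.le).symm
    obtain ⟨a, ha, ha'⟩ := Finset.not_subset.1 h1
    obtain ⟨b, hb, hb'⟩ := Finset.not_subset.1 h2
    exact lt_asymm ((h a ha).2 b hb') ((h' b hb).2 a ha')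

/-- A map on the sphere that contracts to a point extends to the closed ball. -/
theorem exists_extension_closedBall_of_contraction {Z : Type*} [TopologicalSpace Z] {k : ℕ}
    (H : Metric.sphere (0 : EuclideanSpace ℝ (Fin (k + 1))) 1 × Icc (0 : ℝ) 1 → Z)
    (hH : Continuous H) (c : Z) (h0 : ∀ z, H (z, 0) = c) :
    ∃ g : Metric.closedBall (0 : EuclideanSpace ℝ (Fin (k + 1))) 1 → Z,
      Continuous g ∧ range g ⊆ range H ∧
        ∀ z, g (inclusion Metric.sphere_subset_closedBall z) = H (z, 1) := by
  let q : Metric.sphere (0 : EuclideanSpace ℝ (Fin (k + 1))) 1 × Icc (0 : ℝ) 1 →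
      Metric.closedBall (0 : EuclideanSpace ℝ (Fin (k + 1))) 1 := fun p =>
    ⟨(p.2 : ℝ) • (p.1 : EuclideanSpace ℝ (Fin (k + 1))), by
      have h1 : ‖(p.1 : EuclideanSpace ℝ (Fin (k + 1)))‖ = 1 := by simp
      rw [mem_closedBall_zero_iff, norm_smul, h1, mul_one, Real.norm_eq_abs,
        abs_of_nonneg p.2.2.1]
      exact p.2.2.2⟩
  have hnorm : ∀ z : Metric.sphere (0 : EuclideanSpace ℝ (Fin (k + 1))) 1,
      ‖(z : EuclideanSpace ℝ (Fin (k + 1)))‖ = 1 := fun z => by simp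
  have hq : Continuous q := by
    refine Continuous.subtype_mk ?_ _
    fun_prop
  have hsurj : Function.Surjective q := by
    rintro ⟨w, hw⟩
    rw [mem_closedBall_zero_iff] at hw
    obtain ⟨z0⟩ : Nonempty (Metric.sphere (0 : EuclideanSpace ℝ (Fin (k + 1))) 1) :=
      (NormedSpace.sphere_nonempty.2 zero_le_one).to_subtype
    by_cases h : w = 0
    · exact ⟨(z0, 0), Subtype.ext (by simp [q, h])⟩
    · have hn : ‖w‖ ≠ 0 := norm_ne_zero_iff.2 h
      refine ⟨(⟨‖w‖⁻¹ • w, by simp [norm_smul, hn]⟩, ⟨‖w‖, norm_nonneg _, hw⟩), Subtype.ext ?_⟩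
      simp [q, smul_smul, hn]
  have hquot : IsQuotientMap q := hq.isClosedMap.isQuotientMap hq hsurj
  have hfac : ∀ p p', q p = q p' → H p = H p' := by
    rintro ⟨z, s, hs⟩ ⟨z', s', hs'⟩ h
    have h1 : s • (z : EuclideanSpace ℝ (Fin (k + 1))) = s' • z' := congrArg Subtype.val h
    have h2 : s = s' := by
      have := congrArg norm h1
      rwa [norm_smul, norm_smul, hnorm, hnorm, mul_one, mul_one, Real.norm_eq_abs,
        Real.norm_eq_abs, abs_of_nonneg hs.1, abs_of_nonneg hs'.1] at this
    subst h2
    by_cases hz : s = 0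
    · subst hz
      exact (h0 z).trans (h0 z').symm
    · rw [Subtype.ext (smul_right_injective _ hz h1)]
  refine ⟨fun w => H (Function.surjInv hsurj w), ?_, ?_, fun z => ?_⟩
  · rw [hquot.continuous_iff]
    convert hH using 1
    ext p
    exact hfac _ _ (Function.surjInv_eq hsurj _)
  · rintro _ ⟨w, rfl⟩
    exact mem_range_self _
  · refine hfac _ _ ((Function.surjInv_eq hsurj _).trans (Subtype.ext ?_))
    simp [q]

/-- The points of the `(k+1)`-fold join of the discrete set `T`, given by (unnormalized)
barycentric coordinates; the first index names the factor of the join. -/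
def joinPoints (k : ℕ) (T : Set ℕ) : Set (ℕ → ℕ → ℝ) :=
  {y | (∀ j i, 0 ≤ y j i) ∧ (∀ j i i', y j i ≠ 0 → y j i' ≠ 0 → i = i') ∧
    (∀ j i, y j i ≠ 0 → j ≤ k ∧ i ∈ T) ∧ y ≠ 0}

theorem single_mem_joinPoints {k j i : ℕ} {T : Set ℕ} (hj : j ≤ k) (hi : i ∈ T) :
    (Pi.single j (Pi.single i 1) : ℕ → ℕ → ℝ) ∈ joinPoints k T := by
  have hne : ∀ j' i', (Pi.single j (Pi.single i 1) : ℕ → ℕ → ℝ) j' i' ≠ 0 → j' = j ∧ i' = i := by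
    intro j' i' h
    by_cases hj' : j' = j
    · subst hj'
      by_cases hi' : i' = i
      · exact ⟨rfl, hi'⟩
      · simp [hi'] at h
    · simp [hj'] at h
  refine ⟨fun j' i' => ?_, fun j' a b ha hb => (hne _ _ ha).2.trans (hne _ _ hb).2.symm,
    fun j' i' h => ?_, fun h => ?_⟩
  · have : (0 : ℕ → ℕ → ℝ) ≤ Pi.single j (Pi.single i 1) := by simp
    exact this j' i'
  · obtain ⟨rfl, rfl⟩ := hne _ _ h
    exact ⟨hj, hi⟩
  · simpa using congrFun (congrFun h j) i

theorem cone_mem_joinPoints {k i : ℕ} {T : Set ℕ} (hi : i ∈ T) {y : ℕ → ℕ → ℝ}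
    (hy : y ∈ joinPoints k T) {t : ℝ} (ht : t ∈ Icc (0 : ℝ) 1) :
    t • y + (1 - t) • (Pi.single (k + 1) (Pi.single i 1) : ℕ → ℕ → ℝ) ∈ joinPoints (k + 1) T := by
  obtain ⟨h1, h2, h3, h4⟩ := hy
  obtain ⟨e1, e2, e3, -⟩ := single_mem_joinPoints (le_refl (k + 1)) hi
  set e : ℕ → ℕ → ℝ := Pi.single (k + 1) (Pi.single i 1) with he
  have htop : ∀ a, y (k + 1) a = 0 := fun a => by
    by_contra h
    have := (h3 _ _ h).1
    omega
  have hlow : ∀ j, j ≠ k + 1 → ∀ a, e j a = 0 := fun j hj a => by simp [he, hj]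
  have hcases : ∀ j a, (t • y + (1 - t) • e) j a ≠ 0 →
      (y j a ≠ 0 ∧ j ≠ k + 1) ∨ (e j a ≠ 0 ∧ j = k + 1) := by
    intro j a h
    by_cases hj : j = k + 1
    · subst hj
      refine Or.inr ⟨fun h' => h ?_, rfl⟩
      simp [htop, h']
    · refine Or.inl ⟨fun h' => h ?_, hj⟩
      simp [hlow j hj, h']
  refine ⟨fun j a => ?_, fun j a b ha hb => ?_, fun j a h => ?_, fun h => ?_⟩
  · have := mul_nonneg ht.1 (h1 j a)
    have := mul_nonneg (sub_nonneg.2 ht.2) (e1 j a)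
    simp only [Pi.add_apply, Pi.smul_apply, smul_eq_mul]
    linarith
  · rcases hcases j a ha with ⟨ha, hj⟩ | ⟨ha, hj⟩ <;> rcases hcases j b hb with ⟨hb, hj'⟩ | ⟨hb, hj'⟩
    · exact h2 j a b ha hb
    · exact absurd hj' hj
    · exact absurd hj hj'
    · exact e2 j a b ha hb
  · rcases hcases j a h with ⟨h, -⟩ | ⟨h, -⟩
    · exact ⟨(h3 j a h).1.trans (Nat.le_succ k), (h3 j a h).2⟩
    · exact e3 j a h
  · have ht1 : 1 - t = 0 := by
      have := congrFun (congrFun h (k + 1)) i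
      simpa [htop, he] using this
    have : t = 1 := by linarith
    subst this
    exact h4 (by simpa using h)

theorem embedIn_joinPoints (k : ℕ) {T : Set ℕ} (hT : T.Nonempty) :
    EmbedIn k (joinPoints k T) (joinPoints (k + 1) T) := by
  intro f hf hr
  obtain ⟨i, hi⟩ := hT
  obtain ⟨g, hg, hgr, hgf⟩ := exists_extension_closedBall_of_contraction
    (fun p : Metric.sphere (0 : EuclideanSpace ℝ (Fin (k + 1))) 1 × Icc (0 : ℝ) 1 =>
      (p.2 : ℝ) • f p.1 +
        (1 - (p.2 : ℝ)) • (Pi.single (k + 1) (Pi.single i 1) : ℕ → ℕ → ℝ))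
    (by fun_prop) (Pi.single (k + 1) (Pi.single i 1)) (by simp)
  refine ⟨g, hg, hgr.trans ?_, fun z => (hgf z).trans (by simp)⟩
  rintro _ ⟨p, rfl⟩
  exact cone_mem_joinPoints hi (hr (mem_range_self p.1)) p.2.2

theorem lowerLocallyConstant_joinPoints {X : Type*} [TopologicalSpace X] (k : ℕ) {A : ℕ → Set X}
    (hA : ∀ i, IsOpen (A i)) (hfin : ∀ x, {i | x ∈ A i}.Finite) :
    LowerLocallyConstant fun x => joinPoints k {i | x ∈ A i} := by
  intro K _
  rw [isOpen_iff_mem_nhds]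
  intro x hx
  filter_upwards [((hfin x).isOpen_biInter fun i _ => hA i).mem_nhds
    (mem_iInter₂.2 fun i hi => hi)] with z hz y hy
  obtain ⟨h1, h2, h3, h4⟩ := hx hy
  exact ⟨h1, h2, fun j i h => ⟨(h3 j i h).1, mem_iInter₂.1 hz i (h3 j i h).2⟩, h4⟩

theorem covDimLE_of_selection {X : Type*} [TopologicalSpace X] [T2Space X] [ParacompactSpace X]
    (n : ℕ)
    (hsel : ∀ (Y : Type) [TopologicalSpace Y] [T2Space Y] (φ : ℕ → X → Set Y),
      (∀ k, k ≤ n → ∀ x, (φ k x).Nonempty) →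
      (∀ k, k ≤ n → LowerLocallyConstant (φ k)) →
      (∀ k, k < n → ∀ x, EmbedIn k (φ k x) (φ (k + 1) x)) →
      ∃ f : X → Y, Continuous f ∧ ∀ x, f x ∈ φ n x) :
    CovDimLE X n := by
  intro U hUo hU
  obtain ⟨W, hWo, hWU, hWc, hWd⟩ := exists_disjoint_of_card_eq_refinement
    (fun u : U => (u : Set X)) (fun u => hUo u u.2) (by rw [← sUnion_eq_iUnion, hU])
  obtain ⟨A, hAo, hAc, hAf, hAW⟩ := precise_refinement
    (fun k : ℕ => ⋃ F : {F : Finset U // F.card = k}, W F)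
    (fun k => isOpen_iUnion fun F => hWo F)
    (iUnion_eq_univ_iff.2 fun x => by
      obtain ⟨F, hF⟩ := hWc x
      exact ⟨F.card, mem_iUnion.2 ⟨⟨F, rfl⟩, hF⟩⟩)
  have hne : ∀ x, {i | x ∈ A i}.Nonempty := fun x => iUnion_eq_univ_iff.1 hAc x
  obtain ⟨f, hf, hfA⟩ := hsel (ℕ → ℕ → ℝ) (fun k x => joinPoints k {i | x ∈ A i})
    (fun k _ x => (hne x).elim fun i hi => ⟨_, single_mem_joinPoints k.zero_le hi⟩)
    (fun k _ => lowerLocallyConstant_joinPoints k hAo fun x => hAf.point_finite x)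
    (fun k _ x => embedIn_joinPoints k (hne x))
  let v : ℕ × Finset U → Set X := fun p => {x | f x p.1 p.2.card ≠ 0} ∩ W p.2
  have hinj : ∀ x, InjOn Prod.fst {p | x ∈ v p} := by
    rintro x ⟨j, F⟩ ⟨h1, h2⟩ ⟨_, F'⟩ ⟨h1', h2'⟩ rfl
    rw [hWd F F' x ((hfA x).2.1 j _ _ h1 h1') h2 h2']
  have hmaps : ∀ x, MapsTo Prod.fst {p | x ∈ v p} (Iio (n + 1)) := fun x p hp =>
    Nat.lt_succ_of_le ((hfA x).2.2.1 _ _ hp.1).1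
  have hfinite : ∀ x, {p | x ∈ v p}.Finite := fun x =>
    Finite.of_injOn (hmaps x) (hinj x) (finite_Iio _)
  have himage : ∀ x, {s ∈ v '' {p | (v p).Nonempty} | x ∈ s} ⊆ v '' {p | x ∈ v p} := by
    rintro x _ ⟨⟨p, -, rfl⟩, hx⟩
    exact ⟨p, hx, rfl⟩
  refine ⟨v '' {p | (v p).Nonempty}, ?_, ?_, ?_, fun x =>
    ⟨((hfinite x).image v).subset (himage x), ?_⟩⟩
  · rintro _ ⟨p, -, rfl⟩
    exact (isOpen_ne_fun (by fun_prop) continuous_const).inter (hWo _)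
  · rintro _ ⟨p, hp, rfl⟩
    obtain ⟨u, hu⟩ := hWU p.2 (hp.mono inter_subset_right)
    exact ⟨u, u.2, inter_subset_right.trans hu⟩
  · refine eq_univ_of_forall fun x => ?_
    obtain ⟨-, -, h3, h4⟩ := hfA x
    obtain ⟨j, hj⟩ := Function.ne_iff.1 h4
    obtain ⟨i, hi⟩ := Function.ne_iff.1 hj
    obtain ⟨⟨F, rfl⟩, hF⟩ := mem_iUnion.1 (hAW i (h3 j i hi).2)
    exact mem_sUnion.2 ⟨v (j, F), ⟨(j, F), ⟨x, hi, hF⟩, rfl⟩, hi, hF⟩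
  · calc _ ≤ (v '' {p | x ∈ v p}).ncard := ncard_le_ncard (himage x) ((hfinite x).image v)
      _ ≤ {p | x ∈ v p}.ncard := ncard_image_le (hfinite x)
      _ ≤ (Iio (n + 1)).ncard := ncard_le_ncard_of_injOn _ (hmaps x) (hinj x) (finite_Iio _)
      _ = n + 1 := by simp [← Finset.coe_Iio, ncard_coe_finset]

/-- The face of the standard simplex on `I` spanned by `F`. -/
def faceSimplex {I : Type*} (F : Finset I) : Set (I → ℝ) :=
  {w | (∀ i, 0 ≤ w i) ∧ (∀ i ∉ F, w i = 0) ∧ ∑ i ∈ F, w i = 1}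

section faceSimplex

variable {I J : Type*}

theorem isClosed_faceSimplex (F : Finset I) : IsClosed (faceSimplex F) := by
  simp only [faceSimplex, ofPred_and, ofPred_forall]
  refine .inter (isClosed_iInter fun i => isClosed_le (by fun_prop) (by fun_prop)) (.inter
    (isClosed_iInter fun i => isClosed_iInter fun _ => isClosed_eq (by fun_prop) (by fun_prop))
    (isClosed_eq (by fun_prop) (by fun_prop)))

theorem faceSimplex_mono {F G : Finset I} (h : F ⊆ G) : faceSimplex F ⊆ faceSimplex G :=
  fun _ hw => ⟨hw.1, fun i hi => hw.2.1 i fun h' => hi (h h'),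
    by rw [← hw.2.2, Finset.sum_subset h fun i _ hi => hw.2.1 i hi]⟩

theorem isCompact_faceSimplex (F : Finset I) : IsCompact (faceSimplex F) := by
  refine (isCompact_univ_pi fun _ : I => isCompact_Icc (a := (0 : ℝ)) (b := 1)).of_isClosed_subset
    (isClosed_faceSimplex F) fun w hw i _ => ⟨hw.1 i, ?_⟩
  by_cases hi : i ∈ F
  · exact (Finset.single_le_sum (fun j _ => hw.1 j) hi).trans hw.2.2.le
  · exact (hw.2.1 i hi).trans_le zero_le_one

theorem nonempty_of_mem_faceSimplex {F : Finset I} {w : I → ℝ} (hw : w ∈ faceSimplex F) :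
    F.Nonempty := by
  by_contra h
  have := hw.2.2
  simp [Finset.not_nonempty_iff_eq_empty.1 h] at this

theorem exists_support_eq_of_mem_faceSimplex {F : Finset I} {w : I → ℝ}
    (hw : w ∈ faceSimplex F) :
    ∃ G ⊆ F, Function.support w = ↑G ∧ w ∈ faceSimplex G := by
  classical
  refine ⟨F.filter fun i => w i ≠ 0, Finset.filter_subset _ _, ?_, hw.1, fun i hi => ?_, ?_⟩
  · ext i
    simp only [Function.mem_support, Finset.coe_filter, mem_ofPred_eq]
    exact ⟨fun h => ⟨by_contra fun h' => h (hw.2.1 i h'), h⟩, fun h => h.2⟩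
  · by_contra h
    exact hi (Finset.mem_filter.2 ⟨by_contra fun h' => h (hw.2.1 i h'), h⟩)
  · rw [Finset.sum_filter_ne_zero, hw.2.2]

/-- The simplicial map induced by a map of vertices. -/
noncomputable def pushWeights (p : J → I) (w : J → ℝ) (i : I) : ℝ :=
  ∑ᶠ j ∈ p ⁻¹' {i}, w j

open Classical in
theorem pushWeights_apply (p : J → I) {F : Finset J} {w : J → ℝ} (hw : w ∈ faceSimplex F) (i : I) :
    pushWeights p w i = ∑ j ∈ F with p j = i, w j := by
  refine finsum_mem_eq_sum_of_inter_support_eq _ ?_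
  ext j
  simp only [mem_inter_iff, mem_preimage, mem_singleton_iff, Function.mem_support,
    Finset.coe_filter, mem_ofPred_eq]
  exact ⟨fun h => ⟨⟨by_contra fun h' => h.2 (hw.2.1 j h'), h.1⟩, h.2⟩, fun h => ⟨h.1.2, h.2⟩⟩

open Classical in
theorem pushWeights_mem (p : J → I) {F : Finset J} {w : J → ℝ}
    (hw : w ∈ faceSimplex F) : pushWeights p w ∈ faceSimplex (F.image p) := by
  refine ⟨fun i => ?_, fun i hi => ?_, ?_⟩
  · rw [pushWeights_apply p hw]
    exact Finset.sum_nonneg fun j _ => hw.1 j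
  · rw [pushWeights_apply p hw, Finset.sum_eq_zero]
    intro j hj
    obtain ⟨hjF, hji⟩ := Finset.mem_filter.1 hj
    exact absurd (hji ▸ Finset.mem_image_of_mem p hjF) hi
  · simp_rw [pushWeights_apply p hw]
    rw [← hw.2.2]
    exact Finset.sum_fiberwise_of_maps_to (fun j hj => Finset.mem_image_of_mem p hj) w

theorem continuousOn_pushWeights (p : J → I) (F : Finset J) :
    ContinuousOn (pushWeights p) (faceSimplex F) := by
  classical
  have : Continuous fun (w : J → ℝ) (i : I) => ∑ j ∈ F with p j = i, w j := by fun_prop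
  exact this.continuousOn.congr fun w hw => funext fun i => pushWeights_apply p hw i

end faceSimplex

section extension

variable {Y : Type*} [TopologicalSpace Y] {k : ℕ} {S B : Set Y}

/-- The boundary of the standard simplex and the simplex itself may replace the sphere and the
ball in `EmbedIn`. -/
theorem EmbedIn.exists_extension_stdSimplex (hSB : EmbedIn k S B) (u : (Fin (k + 2) → ℝ) → Y)
    (hu : ContinuousOn u {w ∈ stdSimplex ℝ (Fin (k + 2)) | ∃ j, w j = 0})
    (huS : MapsTo u {w ∈ stdSimplex ℝ (Fin (k + 2)) | ∃ j, w j = 0} S) :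
    ∃ h : (Fin (k + 2) → ℝ) → Y, ContinuousOn h (stdSimplex ℝ (Fin (k + 2))) ∧
      MapsTo h (stdSimplex ℝ (Fin (k + 2))) B ∧
      EqOn h u {w ∈ stdSimplex ℝ (Fin (k + 2)) | ∃ j, w j = 0} := by
  classical
  let a : EuclideanSpace ℝ (Fin (k + 1)) → Fin (k + 2) → ℝ :=
    fun v => Fin.cons (1 - ∑ i, v i) v.ofLp
  let b : (Fin (k + 2) → ℝ) → EuclideanSpace ℝ (Fin (k + 1)) :=
    fun w => WithLp.toLp 2 fun i => w i.succ
  have ha : Continuous a := by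
    refine continuous_pi fun j => ?_
    refine Fin.cases ?_ (fun i => ?_) j
    · simp only [a, Fin.cons_zero]
      fun_prop
    · simp only [a, Fin.cons_succ]
      fun_prop
  have hb : Continuous b := by fun_prop
  have hasum : ∀ v, ∑ j, a v j = 1 := fun v => by simp [a, Fin.sum_univ_succ]
  have hab : ∀ w : Fin (k + 2) → ℝ, ∑ j, w j = 1 → a (b w) = w := by
    intro w hw
    rw [Fin.sum_univ_succ] at hw
    ext j
    refine Fin.cases ?_ (fun i => ?_) j
    · simp only [a, b, Fin.cons_zero]
      linarith
    · simp only [a, b, Fin.cons_succ]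
  have haff : ∀ v v' : EuclideanSpace ℝ (Fin (k + 1)), ∀ s t : ℝ, s + t = 1 →
      a (s • v + t • v') = s • a v + t • a v' := by
    intro v v' s t hst
    ext j
    refine Fin.cases ?_ (fun i => ?_) j
    · simp only [a, Fin.cons_zero, PiLp.add_apply, PiLp.smul_apply, smul_eq_mul, Pi.add_apply,
        Pi.smul_apply, Finset.sum_add_distrib, ← Finset.mul_sum]
      linear_combination -hst
    · simp [a]
  let C : Set (EuclideanSpace ℝ (Fin (k + 1))) := {v | ∀ j, 0 ≤ a v j}
  have hCconv : Convex ℝ C := by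
    intro v hv v' hv' s t hs ht hst j
    rw [haff v v' s t hst]
    exact add_nonneg (mul_nonneg hs (hv j)) (mul_nonneg ht (hv' j))
  have hCclosed : IsClosed C := by
    simp only [C, ofPred_forall]
    exact isClosed_iInter fun j => isClosed_le continuous_const ((continuous_apply j).comp ha)
  have hCint : ∀ v, (∀ j, 0 < a v j) → v ∈ interior C := by
    intro v hv
    refine mem_interior.2 ⟨{v | ∀ j, 0 < a v j}, fun v' hv' j => (hv' j).le, ?_, hv⟩
    simp only [ofPred_forall]
    exact isOpen_iInter_of_finite fun j =>
      isOpen_lt continuous_const ((continuous_apply j).comp ha)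
  obtain ⟨c, hc⟩ : ∃ c, ∀ j, 0 < a c j := by
    refine ⟨b fun _ => ((k : ℝ) + 2)⁻¹, ?_⟩
    rw [hab fun _ => ((k : ℝ) + 2)⁻¹]
    · intro j
      positivity
    · simp only [Finset.sum_const, Finset.card_univ, Fintype.card_fin, nsmul_eq_mul]
      push_cast
      field_simp
  have hCbdd : Bornology.IsBounded C := by
    refine ((isCompact_Icc (a := (0 : Fin (k + 1) → ℝ)) (b := 1)).image
      (PiLp.continuous_toLp 2 _)).isBounded.subset fun v hv => ⟨v.ofLp, ⟨fun i => ?_, fun i => ?_⟩, rfl⟩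
    · simpa [a] using hv i.succ
    · have h1 : a v i.succ ≤ ∑ j, a v j :=
        Finset.single_le_sum (f := a v) (fun j _ => hv j) (Finset.mem_univ _)
      rw [hasum] at h1
      simpa [a] using h1
  have hCbd : ∀ v j, a v j = 0 → v ∉ interior C := by
    intro v j hj hv
    have hline : Filter.Tendsto (fun t : ℝ => (1 + t) • v + (-t) • c) (𝓝[>] 0) (𝓝 v) := by
      have : Continuous fun t : ℝ => (1 + t) • v + (-t) • c := by fun_prop
      simpa using (this.tendsto 0).mono_left nhdsWithin_le_nhds
    obtain ⟨t, htC, ht⟩ := ((hline.eventually (isOpen_interior.mem_nhds hv)).and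
      self_mem_nhdsWithin).exists
    have h1 := interior_subset htC j
    rw [haff v c _ _ (by ring)] at h1
    simp only [Pi.add_apply, Pi.smul_apply, hj, smul_eq_mul, mul_zero, zero_add] at h1
    have := mul_pos (show 0 < t from ht) (hc j)
    linarith
  obtain ⟨Φ, -, hΦC, hΦS⟩ := exists_homeomorph_image_interior_closure_frontier_eq_unitBall
    hCconv ⟨c, hCint c hc⟩ hCbdd
  rw [hCclosed.closure_eq] at hΦC
  rw [hCclosed.frontier_eq] at hΦS
  have hbC : ∀ w ∈ stdSimplex ℝ (Fin (k + 2)), Φ (b w) ∈ Metric.closedBall 0 1 := by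
    intro w hw
    rw [← hΦC]
    refine mem_image_of_mem _ fun j => ?_
    rw [hab w hw.2]
    exact hw.1 j
  have hbS : ∀ w ∈ stdSimplex ℝ (Fin (k + 2)), (∃ j, w j = 0) →
      Φ (b w) ∈ Metric.sphere 0 1 := by
    rintro w hw ⟨j, hj⟩
    rw [← hΦS]
    refine mem_image_of_mem _ ⟨fun j => ?_, hCbd _ j ?_⟩ <;> rw [hab w hw.2]
    · exact hw.1 j
    · exact hj
  have haS : ∀ z : Metric.sphere (0 : EuclideanSpace ℝ (Fin (k + 1))) 1,
      a (Φ.symm z) ∈ {w ∈ stdSimplex ℝ (Fin (k + 2)) | ∃ j, w j = 0} := by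
    rintro ⟨z, hz⟩
    rw [← hΦS] at hz
    obtain ⟨v, ⟨hv, hv'⟩, rfl⟩ := hz
    rw [Φ.symm_apply_apply]
    refine ⟨⟨hv, hasum v⟩, ?_⟩
    by_contra! h
    exact hv' (hCint v fun j => (hv j).lt_of_ne (h j).symm)
  obtain ⟨g, hg, hgB, hgu⟩ := hSB (fun z => u (a (Φ.symm z)))
    (hu.comp_continuous (by fun_prop) haS) (by
      rintro _ ⟨z, rfl⟩
      exact huS (haS z))
  refine ⟨fun w => if hw : Φ (b w) ∈ Metric.closedBall 0 1 then g ⟨Φ (b w), hw⟩ else u w,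
    ?_, fun w hw => ?_, fun w hw => ?_⟩
  · rw [continuousOn_iff_continuous_domRestrict]
    have : Continuous fun w : stdSimplex ℝ (Fin (k + 2)) =>
        g ⟨Φ (b w.1), hbC w.1 w.2⟩ :=
      hg.comp (Continuous.subtype_mk (by fun_prop) _)
    convert this using 1
    ext w
    simp only [domRestrict_apply]
    rw [dif_pos (hbC w.1 w.2)]
  · simp only
    rw [dif_pos (hbC w hw)]
    exact hgB (mem_range_self _)
  · simp only
    rw [dif_pos (hbC w hw.1)]
    refine (hgu ⟨Φ (b w), hbS w hw.1 hw.2⟩).trans ?_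
    simp only [Φ.symm_apply_apply]
    rw [hab w hw.1.2]

theorem EmbedIn.exists_extension_faceSimplex {I : Type*} [DecidableEq I] (hSB : EmbedIn k S B)
    {G : Finset I} (hG : G.card = k + 2) (u : (I → ℝ) → Y)
    (hu : ∀ i ∈ G, ContinuousOn u (faceSimplex (G.erase i)))
    (huS : ∀ i ∈ G, MapsTo u (faceSimplex (G.erase i)) S) :
    ∃ h : (I → ℝ) → Y, ContinuousOn h (faceSimplex G) ∧ MapsTo h (faceSimplex G) B ∧
      ∀ i ∈ G, EqOn h u (faceSimplex (G.erase i)) := by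
  classical
  let e : G ≃ Fin (k + 2) := G.equivFinOfCardEq hG
  let s : (Fin (k + 2) → ℝ) → I → ℝ := fun w i => if hi : i ∈ G then w (e ⟨i, hi⟩) else 0
  let r : (I → ℝ) → Fin (k + 2) → ℝ := fun w j => w (e.symm j)
  have hs : Continuous s := by
    refine continuous_pi fun i => ?_
    by_cases hi : i ∈ G
    · simp only [s, dif_pos hi]
      fun_prop
    · simp only [s, dif_neg hi]
      fun_prop
  have hr : Continuous r := by fun_prop
  have hsr : ∀ w ∈ faceSimplex G, s (r w) = w := by
    intro w hw
    ext i
    by_cases hi : i ∈ G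
    · simp [s, r, hi]
    · simp [s, hi, hw.2.1 i hi]
  have hrsum : ∀ w : I → ℝ, ∑ j, r w j = ∑ i ∈ G, w i := by
    intro w
    rw [← Finset.sum_coe_sort G w]
    exact e.symm.sum_comp (fun i : G => w i)
  have hrG : ∀ w ∈ faceSimplex G, r w ∈ stdSimplex ℝ (Fin (k + 2)) := fun w hw =>
    ⟨fun j => hw.1 _, (hrsum w).trans hw.2.2⟩
  have hrbd : ∀ i ∈ G, ∀ w ∈ faceSimplex (G.erase i),
      r w ∈ {w ∈ stdSimplex ℝ (Fin (k + 2)) | ∃ j, w j = 0} := by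
    intro i hi w hw
    refine ⟨hrG w (faceSimplex_mono (Finset.erase_subset _ _) hw), e ⟨i, hi⟩, ?_⟩
    simpa [r] using hw.2.1 i (Finset.notMem_erase i G)
  have hrs : ∀ w, r (s w) = w := fun w => by
    ext j
    simp [r, s]
  have hsbd : ∀ w ∈ {w ∈ stdSimplex ℝ (Fin (k + 2)) | ∃ j, w j = 0},
      ∃ i : G, s w ∈ faceSimplex (G.erase i) := by
    rintro w ⟨hw, j, hj⟩
    have hzero : s w (e.symm j) = 0 := by simp [s, hj]
    refine ⟨e.symm j, fun i => ?_, fun i hi => ?_, ?_⟩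
    · by_cases hi : i ∈ G
      · simpa [s, hi] using hw.1 _
      · simp [s, hi]
    · by_cases hiG : i ∈ G
      · obtain rfl : i = e.symm j := by
          by_contra h
          exact hi (Finset.mem_erase.2 ⟨h, hiG⟩)
        exact hzero
      · simp [s, hiG]
    · rw [Finset.sum_erase _ hzero, ← hrsum, hrs, hw.2]
  have hcont : ContinuousOn u (⋃ i : G, faceSimplex (G.erase i)) :=
    (locallyFinite_of_finite _).continuousOn_iUnion (fun i => isClosed_faceSimplex _)
      fun i => hu i i.2
  obtain ⟨h, hh, hhB, hhu⟩ := hSB.exists_extension_stdSimplex (u ∘ s)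
    (hcont.comp hs.continuousOn fun w hw => mem_iUnion.2 (hsbd w hw)) (fun w hw => by
      obtain ⟨i, hi⟩ := hsbd w hw
      exact huS i i.2 hi)
  refine ⟨h ∘ r, hh.comp hr.continuousOn hrG, fun w hw => hhB (hrG w hw), fun i hi w hw => ?_⟩
  refine (hhu (hrbd i hi w hw)).trans ?_
  simp only [Function.comp_apply]
  rw [hsr w (faceSimplex_mono (Finset.erase_subset _ _) hw)]

/-- A map on the `k`-skeleton of a finite simplex extends to the `(k+1)`-skeleton. -/
theorem EmbedIn.exists_extension_skeleton {I : Type*} (hSB : EmbedIn k S B) (hsub : S ⊆ B)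
    (T : Finset I) (u : (I → ℝ) → Y)
    (hu : ∀ G ⊆ T, G.card ≤ k + 1 → ContinuousOn u (faceSimplex G))
    (huS : ∀ G ⊆ T, G.card ≤ k + 1 → MapsTo u (faceSimplex G) S) :
    ∃ h : (I → ℝ) → Y,
      (∀ G ⊆ T, G.card ≤ k + 2 → ContinuousOn h (faceSimplex G) ∧ MapsTo h (faceSimplex G) B) ∧
      ∀ G, G.card ≤ k + 1 → EqOn h u (faceSimplex G) := by
  classical
  have hext : ∀ G : Finset I, G ⊆ T → G.card = k + 2 → ∃ h : (I → ℝ) → Y,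
      ContinuousOn h (faceSimplex G) ∧ MapsTo h (faceSimplex G) B ∧
        ∀ i ∈ G, EqOn h u (faceSimplex (G.erase i)) := by
    intro G hGT hG
    have hsubT : ∀ i, G.erase i ⊆ T := fun i => (Finset.erase_subset i G).trans hGT
    have hcard : ∀ i ∈ G, (G.erase i).card ≤ k + 1 := fun i hi => by
      rw [Finset.card_erase_of_mem hi, hG]
      omega
    exact hSB.exists_extension_faceSimplex hG u (fun i hi => hu _ (hsubT i) (hcard i hi))
      fun i hi => huS _ (hsubT i) (hcard i hi)
  have hnonempty : Nonempty ((I → ℝ) → Y) := ⟨u⟩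
  choose! f hf hfB hfu using hext
  let h : (I → ℝ) → Y := fun w =>
    if H : ∃ G : Finset I, G ⊆ T ∧ G.card = k + 2 ∧ Function.support w = ↑G then f H.choose w
    else u w
  have hlow : ∀ G : Finset I, G.card ≤ k + 1 → EqOn h u (faceSimplex G) := by
    intro G hG w hw
    refine dif_neg ?_
    rintro ⟨G', -, hG', hsupp⟩
    obtain ⟨G'', hG''G, hsupp', -⟩ := exists_support_eq_of_mem_faceSimplex hw
    rw [hsupp, Finset.coe_inj] at hsupp'
    subst hsupp'
    have := Finset.card_le_card hG''G
    omega
  have htop : ∀ G ⊆ T, G.card = k + 2 → EqOn h (f G) (faceSimplex G) := by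
    intro G hGT hG w hw
    obtain ⟨G', hG'G, hsupp, hw'⟩ := exists_support_eq_of_mem_faceSimplex hw
    by_cases hne : G' = G
    · subst hne
      have H : ∃ G : Finset I, G ⊆ T ∧ G.card = k + 2 ∧ Function.support w = ↑G :=
        ⟨G', hGT, hG, hsupp⟩
      have hH : H.choose = G' := Finset.coe_injective (H.choose_spec.2.2.symm.trans hsupp)
      simp only [h, dif_pos H, hH]
    · obtain ⟨i, hiG, hi⟩ := Finset.exists_of_ssubset (hG'G.ssubset_of_ne hne)
      have hsub' : G' ⊆ G.erase i := fun j hj =>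
        Finset.mem_erase.2 ⟨fun hji => hi (hji ▸ hj), hG'G hj⟩
      have hcard := Finset.card_lt_card (hG'G.ssubset_of_ne hne)
      rw [hlow G' (by omega) hw', hfu G hGT hG i hiG (faceSimplex_mono hsub' hw')]
  refine ⟨h, fun G hGT hG => ?_, hlow⟩
  rcases hG.lt_or_eq with hG | hG
  · have hG' : G.card ≤ k + 1 := by omega
    exact ⟨(hu G hGT hG').congr (hlow G hG'),
      ((huS G hGT hG').mono_right hsub).congr (hlow G hG').symm⟩
  · exact ⟨(hf G hGT hG).congr (htop G hGT hG),
      (hfB G hGT hG).congr (htop G hGT hG).symm⟩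

theorem EmbedIn.subset (hSB : EmbedIn k S B) : S ⊆ B := by
  intro y hy
  obtain ⟨g, -, hgB, hgf⟩ := hSB (fun _ => y) continuous_const (by rintro _ ⟨z, rfl⟩; exact hy)
  obtain ⟨z⟩ : Nonempty (Metric.sphere (0 : EuclideanSpace ℝ (Fin (k + 1))) 1) :=
    (NormedSpace.sphere_nonempty.2 zero_le_one).to_subtype
  exact hgf z ▸ hgB (mem_range_self _)

end extension

/-- Every open cover of a paracompact Hausdorff space has an open pointwise star refinement. -/
theorem exists_pointwise_star_refinement {X : Type*} [TopologicalSpace X] [T2Space X]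
    [ParacompactSpace X] (O : X → Set X) (hO : ∀ x, O x ∈ 𝓝 x) :
    ∃ W : X → Set X, (∀ z, IsOpen (W z)) ∧ (∀ z, z ∈ W z) ∧
      ∀ y, ∃ x, ∀ z, y ∈ W z → W z ⊆ O x := by
  obtain ⟨A, hAo, hAc, hAf, hAO⟩ := precise_refinement (fun x => interior (O x))
    (fun x => isOpen_interior)
    (iUnion_eq_univ_iff.2 fun x => ⟨x, mem_interior_iff_mem_nhds.2 (hO x)⟩)
  obtain ⟨B, hBc, -, hBA⟩ := exists_iUnion_eq_closure_subset hAo (fun x => hAf.point_finite x) hAc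
  have hBf : LocallyFinite fun x => closure (B x) := hAf.subset hBA
  let W : X → Set X := fun z =>
    (⋂ x ∈ {x | z ∈ closure (B x)}, A x) ∩ ⋂ (x) (_ : z ∉ closure (B x)), (closure (B x))ᶜ
  have hW : ∀ z, W z ∈ 𝓝 z := fun z =>
    Filter.inter_mem (((hBf.point_finite z).isOpen_biInter fun x _ => hAo x).mem_nhds
      (mem_iInter₂.2 fun x hx => hBA x hx))
      (hBf.iInter_compl_mem_nhds (fun x => isClosed_closure) z)
  refine ⟨fun z => interior (W z), fun z => isOpen_interior,
    fun z => mem_interior_iff_mem_nhds.2 (hW z), fun y => ?_⟩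
  obtain ⟨x, hx⟩ := iUnion_eq_univ_iff.1 hBc y
  refine ⟨x, fun z hyz => ?_⟩
  have hz : z ∈ closure (B x) := by
    by_contra hz
    exact mem_iInter₂.1 (interior_subset hyz).2 x hz (subset_closure hx)
  exact fun t ht => interior_subset (hAO x (mem_iInter₂.1 (interior_subset ht).1 x hz))

/-- `u` maps the part of the `k`-skeleton of the nerve of `U` seen by `x` continuously
into `φ x`, for every `x`. -/
def IsNerveSelection {X Y I : Type*} [TopologicalSpace Y] (k : ℕ) (φ : X → Set Y) (U : I → Set X)
    (u : (I → ℝ) → Y) : Prop :=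
  ∀ x (F : Finset I), (∀ i ∈ F, x ∈ U i) → F.card ≤ k + 1 →
    ContinuousOn u (faceSimplex F) ∧ MapsTo u (faceSimplex F) (φ x)

section selection

variable {X Y : Type*} [TopologicalSpace X] [TopologicalSpace Y]

theorem exists_isNerveSelection_zero [Nonempty Y] {φ : X → Set Y} (hne : ∀ x, (φ x).Nonempty)
    (hφ : LowerLocallyConstant φ) :
    ∃ (U : X → Set X) (u : (X → ℝ) → Y), (∀ x, IsOpen (U x)) ∧ (∀ x, x ∈ U x) ∧
      IsNerveSelection 0 φ U u := by
  classical
  choose y hy using hne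
  refine ⟨fun x => {z | {y x} ⊆ φ z},
    fun w => if h : ∃ x, w x ≠ 0 then y h.choose else Classical.arbitrary Y,
    fun x => hφ _ isCompact_singleton, fun x => singleton_subset_iff.2 (hy x),
    fun z F hF hcard => ?_⟩
  have hconst : ∀ w ∈ faceSimplex F, ∃ x ∈ F,
      (if h : ∃ x, w x ≠ 0 then y h.choose else Classical.arbitrary Y) = y x := by
    intro w hw
    have h : ∃ x, w x ≠ 0 := by
      by_contra! h
      have := hw.2.2
      simp [h] at this
    exact ⟨h.choose, by_contra fun h' => h.choose_spec (hw.2.1 _ h'), dif_pos h⟩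
  refine ⟨?_, fun w hw => ?_⟩
  · rcases F.eq_empty_or_nonempty with rfl | ⟨x, hx⟩
    · intro w hw
      exact absurd (nonempty_of_mem_faceSimplex hw) (by simp)
    · refine (continuousOn_const (c := y x)).congr fun w hw => ?_
      obtain ⟨x', hx', h⟩ := hconst w hw
      rw [h, Finset.card_le_one.1 hcard x' hx' x hx]
  · obtain ⟨x, hx, h⟩ := hconst w hw
    simp only [h]
    exact singleton_subset_iff.1 (hF x hx)

theorem IsNerveSelection.exists_succ [T2Space X] [ParacompactSpace X] {I : Type*} {k : ℕ}
    {φ ψ : X → Set Y} {U : I → Set X} {u : (I → ℝ) → Y} (hu : IsNerveSelection k φ U u)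
    (hUo : ∀ i, IsOpen (U i)) (hUc : ⋃ i, U i = univ)
    (hψ : LowerLocallyConstant ψ) (hφψ : ∀ x, EmbedIn k (φ x) (ψ x)) :
    ∃ (W : X → Set X) (v : (X → ℝ) → Y), (∀ x, IsOpen (W x)) ∧ (∀ x, x ∈ W x) ∧
      IsNerveSelection (k + 1) ψ W v := by
  classical
  obtain ⟨A, hAo, hAc, hAf, hAU⟩ := precise_refinement U hUo hUc
  obtain ⟨V, hVc, hVo, hVA⟩ := exists_iUnion_eq_closure_subset hAo
    (fun x => hAf.point_finite x) hAc
  have hVf : LocallyFinite fun i => closure (V i) := hAf.subset hVA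
  let T : X → Finset I := fun x => (hVf.point_finite x).toFinset
  have hT : ∀ x i, i ∈ T x ↔ x ∈ closure (V i) := fun x i => by simp [T]
  have hTU : ∀ x, ∀ G ⊆ T x, ∀ i ∈ G, x ∈ U i := fun x G hG i hi =>
    hAU i (hVA i ((hT x i).1 (hG hi)))
  choose h hh hhu using fun x => (hφψ x).exists_extension_skeleton (hφψ x).subset (T x) u
    (fun G hG hcard => (hu x G (hTU x G hG) hcard).1)
    (fun G hG hcard => (hu x G (hTU x G hG) hcard).2)
  let K : X → Set Y := fun x =>
    ⋃ G ∈ (T x).powerset.filter fun G => G.card ≤ k + 2, h x '' faceSimplex G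
  have hK : ∀ x, IsCompact (K x) := fun x => Finset.isCompact_biUnion _ fun G hG => by
    obtain ⟨hGT, hG⟩ := Finset.mem_filter.1 hG
    exact (isCompact_faceSimplex G).image_of_continuousOn
      (hh x G (Finset.mem_powerset.1 hGT) hG).1
  have hKψ : ∀ x, K x ⊆ ψ x := fun x => iUnion₂_subset fun G hG => by
    obtain ⟨hGT, hG⟩ := Finset.mem_filter.1 hG
    exact (hh x G (Finset.mem_powerset.1 hGT) hG).2.image_subset
  obtain ⟨W, hWo, hW, hWstar⟩ := exists_pointwise_star_refinement
    (fun x => {z | K x ⊆ ψ z} ∩ ⋂ (i) (_ : x ∉ closure (V i)), (closure (V i))ᶜ)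
    (fun x => Filter.inter_mem ((hψ _ (hK x)).mem_nhds (hKψ x))
      (hVf.iInter_compl_mem_nhds (fun i => isClosed_closure) x))
  choose p hp using fun x => iUnion_eq_univ_iff.1 hVc x
  let c : Set X → X → Prop := fun G x => ∀ z ∈ G, W z ⊆
    {z | K x ⊆ ψ z} ∩ ⋂ (i) (_ : x ∉ closure (V i)), (closure (V i))ᶜ
  let v : (X → ℝ) → Y := fun w =>
    if H : ∃ x, c (Function.support w) x then h H.choose (pushWeights p w)
    else u (pushWeights p w)
  refine ⟨fun z => W z ∩ V (p z), v, fun z => (hWo z).inter (hVo _), fun z => ⟨hW z, hp z⟩,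
    fun y G hG hcard => ?_⟩
  have hcG : ∃ x, c G x := by
    obtain ⟨x, hx⟩ := hWstar y
    exact ⟨x, fun z hz => hx z (hG z hz).1⟩
  have hcT : ∀ x, c G x → G.image p ⊆ T x := by
    intro x hx i hi
    obtain ⟨z, hz, rfl⟩ := Finset.mem_image.1 hi
    rw [hT]
    by_contra hxi
    exact mem_iInter₂.1 (hx z hz (hG z hz).1).2 _ hxi (subset_closure (hG z hz).2)
  have hcard' : (G.image p).card ≤ k + 2 := Finset.card_image_le.trans hcard
  have hveq : EqOn v (fun w => h hcG.choose (pushWeights p w)) (faceSimplex G) := by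
    intro w hw
    obtain ⟨G', hG'G, hsupp, hw'⟩ := exists_support_eq_of_mem_faceSimplex hw
    have H : ∃ x, c (Function.support w) x := by
      rw [hsupp]
      exact hcG.imp fun x hx z hz => hx z (hG'G hz)
    simp only [v, dif_pos H]
    by_cases hne : G' = G
    · subst hne
      congr!
    · have hlt := Finset.card_lt_card (hG'G.ssubset_of_ne hne)
      have hcard'' : (G'.image p).card ≤ k + 1 :=
        Finset.card_image_le.trans (by omega)
      rw [hhu _ _ hcard'' (pushWeights_mem p hw'), hhu _ _ hcard'' (pushWeights_mem p hw')]
  have hx := hcG.choose_spec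
  have hxT := hcT _ hx
  refine ⟨((hh _ _ hxT hcard').1.comp (continuousOn_pushWeights p G)
    fun w hw => pushWeights_mem p hw).congr hveq, fun w hw => ?_⟩
  rw [hveq hw]
  obtain ⟨z, hz⟩ := nonempty_of_mem_faceSimplex hw
  exact (hx z hz (hG z hz).1).1 (mem_iUnion₂.2 ⟨G.image p,
    Finset.mem_filter.2 ⟨Finset.mem_powerset.2 hxT, hcard'⟩,
    mem_image_of_mem _ (pushWeights_mem p hw)⟩)

theorem exists_isNerveSelection [T2Space X] [ParacompactSpace X] [Nonempty Y]
    (φ : ℕ → X → Set Y) (n : ℕ) (hne : ∀ k, k ≤ n → ∀ x, (φ k x).Nonempty)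
    (hφ : ∀ k, k ≤ n → LowerLocallyConstant (φ k))
    (hemb : ∀ k, k < n → ∀ x, EmbedIn k (φ k x) (φ (k + 1) x)) :
    ∀ k, k ≤ n → ∃ (U : X → Set X) (u : (X → ℝ) → Y), (∀ x, IsOpen (U x)) ∧ (∀ x, x ∈ U x) ∧
      IsNerveSelection k (φ k) U u
  | 0, h0 => exists_isNerveSelection_zero (hne 0 h0) (hφ 0 h0)
  | k + 1, hk => by
    obtain ⟨U, u, hUo, hU, hu⟩ :=
      exists_isNerveSelection φ n hne hφ hemb k (Nat.le_of_succ_le hk)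
    exact hu.exists_succ hUo (iUnion_eq_univ_iff.2 fun x => ⟨x, hU x⟩) (hφ _ hk)
      (hemb k hk)

theorem IsNerveSelection.exists_selection [T2Space X] [ParacompactSpace X] {n : ℕ}
    (hdim : CovDimLE X n) {φ : X → Set Y} {U : X → Set X} {u : (X → ℝ) → Y}
    (hu : IsNerveSelection n φ U u) (hUo : ∀ x, IsOpen (U x)) (hU : ∀ x, x ∈ U x) :
    ∃ f : X → Y, Continuous f ∧ ∀ x, f x ∈ φ x := by
  classical
  obtain ⟨𝒱, h𝒱o, h𝒱U, h𝒱c, h𝒱card⟩ := hdim (range U) (by rintro _ ⟨x, rfl⟩; exact hUo x)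
    (by rw [sUnion_range]; exact iUnion_eq_univ_iff.2 fun x => ⟨x, hU x⟩)
  obtain ⟨l, hl⟩ := PartitionOfUnity.exists_isSubordinate isClosed_univ
    (fun s : 𝒱 => (s : Set X)) (fun s => h𝒱o s s.2) (by rw [← sUnion_eq_iUnion, h𝒱c])
  have hp : ∀ s : 𝒱, ∃ x, (s : Set X) ⊆ U x := fun s => by
    obtain ⟨_, ⟨x, rfl⟩, hx⟩ := h𝒱U s s.2
    exact ⟨x, hx⟩
  choose p hp using hp
  let w : X → 𝒱 → ℝ := fun x s => l s x
  have hwc : Continuous w := by fun_prop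
  have hmem : ∀ x (s : 𝒱), s ∈ l.finsupport x → x ∈ (s : Set X) := fun x s hs =>
    hl s (subset_tsupport _ ((l.mem_finsupport x).1 hs))
  have hww : ∀ x (S : Finset 𝒱), l.finsupport x ⊆ S → w x ∈ faceSimplex S := fun x S hS =>
    ⟨fun s => l.nonneg s x,
      fun s hs => by_contra fun h => hs (hS ((l.mem_finsupport x).2 h)),
      l.sum_finsupport' (mem_univ x) hS⟩
  have hcard : ∀ x, ((l.finsupport x).image p).card ≤ n + 1 := by
    intro x
    refine Finset.card_image_le.trans (le_trans ?_ (h𝒱card x).2)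
    rw [← Finset.card_image_of_injective _ Subtype.val_injective, ← ncard_coe_finset]
    refine ncard_le_ncard ?_ (h𝒱card x).1
    intro s hs
    obtain ⟨t, ht, rfl⟩ := Finset.mem_image.1 (Finset.mem_coe.1 hs)
    exact ⟨t.2, hmem x t ht⟩
  have huF : ∀ x, ContinuousOn u (faceSimplex ((l.finsupport x).image p)) ∧
      MapsTo u (faceSimplex ((l.finsupport x).image p)) (φ x) := fun x =>
    hu x _ (fun i hi => by
      obtain ⟨s, hs, rfl⟩ := Finset.mem_image.1 hi
      exact hp s (hmem x s hs)) (hcard x)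
  refine ⟨fun x => u (pushWeights p (w x)), continuous_iff_continuousAt.2 fun x => ?_, fun x =>
    (huF x).2 (pushWeights_mem p (hww x _ subset_rfl))⟩
  let ι := {S : Finset 𝒱 // S ⊆ l.fintsupport x ∧ ∃ z, l.finsupport z = S}
  have : Finite ι := Finite.of_injective
    (fun S : ι => (⟨S.1, Finset.mem_powerset.2 S.2.1⟩ : (l.fintsupport x).powerset))
    fun S S' h => Subtype.ext (congrArg (fun S => (S.1 : Finset 𝒱)) h)
  have hcont : ContinuousOn (fun x => u (pushWeights p (w x)))
      (⋃ S : ι, w ⁻¹' faceSimplex S.1) := by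
    refine (locallyFinite_of_finite _).continuousOn_iUnion
      (fun S => (isClosed_faceSimplex _).preimage hwc) fun ⟨S, hS, z, hz⟩ => ?_
    subst hz
    exact (huF z).1.comp ((continuousOn_pushWeights p _).comp hwc.continuousOn fun y hy => hy)
      fun y hy => pushWeights_mem p hy
  refine hcont.continuousAt ?_
  filter_upwards [l.eventually_finsupport_subset x] with y hy
  exact mem_iUnion.2 ⟨⟨l.finsupport y, hy, y, rfl⟩, hww y _ subset_rfl⟩

end selection

/-- A paracompact Hausdorff space has covering dimension at most `n` iff for every
finite aspherical sequence `φ_0, …, φ_n` of lower locally constant mappings into any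
Hausdorff space, the mapping `φ_n` has a continuous selection. -/
theorem covDimLE_iff_finiteAsphericalSequence_selection
    {X : Type*} [TopologicalSpace X] [T2Space X] [ParacompactSpace X] (n : ℕ) :
    CovDimLE X n ↔
      ∀ (Y : Type) [TopologicalSpace Y] [T2Space Y] (φ : ℕ → X → Set Y),
        (∀ k, k ≤ n → ∀ x, (φ k x).Nonempty) →
        (∀ k, k ≤ n → LowerLocallyConstant (φ k)) →
        (∀ k, k < n → ∀ x, EmbedIn k (φ k x) (φ (k + 1) x)) →
        ∃ f : X → Y, Continuous f ∧ ∀ x, f x ∈ φ n x := by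
  refine ⟨fun hdim Y _ _ φ hne hφ hemb => ?_, covDimLE_of_selection n⟩
  rcases isEmpty_or_nonempty X with hX | ⟨⟨x⟩⟩
  · exact ⟨isEmptyElim, continuous_of_const isEmptyElim, isEmptyElim⟩
  · have : Nonempty Y := (hne n le_rfl x).to_subtype.map Subtype.val
    obtain ⟨U, u, hUo, hU, hu⟩ := exists_isNerveSelection φ n hne hφ hemb n le_rfl
    exact hu.exists_selection hdim hUo hU
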